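/- arXiv:2012.05603 — 3 statements merged into one kernel-verified Lean document; each statement's English description precedes it below -/
import Mathlib

section
/- When restricted to singletons, potential joint parenthood coincides with potential parenthood: for distinct endogenous variables X, Y, distinct values x, x' ∈ R(X) and y, y' ∈ R(Y), the pair x rather than x' is a potential joint parent of y rather than y' (i.e., there exist Z⃗ ⊆ V ∪ U and a setting z⃗ ∈ R(Z⃗) such that (z⃗,x) is directly sufficient for y, (z⃗,x') is directly sufficient for y', and {X} is minimal) if and only if there exist a context u⃗ and a setting z⃗ of the endogenous variables other than X and Y such that F_Y(x,z⃗,u⃗) = y and F_Y(x',z⃗,u⃗) = y'. -/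
set_option linter.unusedVariables false

attribute [local instance] Classical.propDecidable

/-- A causal model `M = ((U,V,R),F)` with exogenous variables `U`, endogenous
variables `V`, ranges `RU u` / `RV v`, and for each endogenous variable a
structural equation giving its value in terms of the values of all the other
variables (the equation may not depend on the variable's own value). -/
structure CausalModel (U V : Type) (RU : U → Type) (RV : V → Type) where
  F : ∀ X : V, (∀ u, RU u) → (∀ v, RV v) → RV X
  selfIndep : ∀ (X : V) (ctx : ∀ u, RU u) (a a' : ∀ v, RV v),
    (∀ Y : V, Y ≠ X → a Y = a' Y) → F X ctx a = F X ctx a'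

namespace CausalModel

variable {U V : Type} {RU : U → Type} {RV : V → Type}

/-- `Y` depends on the endogenous variable `X`: for some context and some setting
of the endogenous variables, varying the value of `X` changes the value of `F Y`.
(`X` is then an (endogenous) parent of `Y`.) -/
def DependsOnE (M : CausalModel U V RU RV) (Y X : V) : Prop :=
  X ≠ Y ∧ ∃ (ctx : ∀ u, RU u) (a : ∀ v, RV v) (x x' : RV X),
    M.F Y ctx (Function.update a X x) ≠ M.F Y ctx (Function.update a X x')

/-- `Y` depends on the exogenous variable `X`. -/
def DependsOnX (M : CausalModel U V RU RV) (Y : V) (X : U) : Prop :=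
  ∃ (ctx : ∀ u, RU u) (a : ∀ v, RV v) (x x' : RU X),
    M.F Y (Function.update ctx X x) a ≠ M.F Y (Function.update ctx X x') a

/-- `M` is strongly recursive: there is a (strict) partial order on the
endogenous variables such that whenever `Y` depends on `X`, `X` strictly
precedes `Y`. -/
def StronglyRecursive (M : CausalModel U V RU RV) : Prop :=
  ∃ lt : V → V → Prop, IsStrictOrder V lt ∧ ∀ Y X : V, M.DependsOnE Y X → lt X Y

/-- `a` simultaneously satisfies all structural equations of `M` in context `ctx`. -/
def Solves (M : CausalModel U V RU RV) (ctx : ∀ u, RU u) (a : ∀ v, RV v) : Prop :=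
  ∀ X : V, a X = M.F X ctx a

/-- `(M,ctx) ⊨ P`: `P` holds of the solution of the equations of `M` in context `ctx`. -/
def Sat (M : CausalModel U V RU RV) (ctx : ∀ u, RU u) (P : (∀ v, RV v) → Prop) : Prop :=
  ∀ a, M.Solves ctx a → P a

/-- The intervened model `M_{S ← b}`: the equation of each variable in `S` is
replaced by the constant value given by `b`; other equations are unchanged. -/
noncomputable def intervene (M : CausalModel U V RU RV) (S : Set V) (b : ∀ v, RV v) :
    CausalModel U V RU RV where
  F X ctx a := if X ∈ S then b X else M.F X ctx a
  selfIndep := by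
    intro X ctx a a' h
    by_cases hX : X ∈ S
    · simp [hX]
    · simpa [hX] using M.selfIndep X ctx a a' h

/-- `X` is a parent of `Y` (both endogenous). -/
def ParentE (M : CausalModel U V RU RV) (X Y : V) : Prop := M.DependsOnE Y X

/-- `X` is an ancestor of `Y` (both endogenous): transitive closure of parenthood. -/
def AncestorE (M : CausalModel U V RU RV) : V → V → Prop :=
  Relation.TransGen fun X Y => M.DependsOnE Y X

/-- The exogenous variable `X` is an ancestor of the endogenous variable `Y`. -/
def AncestorX (M : CausalModel U V RU RV) (X : U) (Y : V) : Prop :=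
  ∃ Z : V, M.DependsOnX Z X ∧ (Z = Y ∨ M.AncestorE Z Y)

/-- `(x,x') ⤳ (y,y')` with witness `(ctx, z)`:
`F_Y(x,z,ctx) = y` and `F_Y(x',z,ctx) = y'`. -/
def LeadsToWith (M : CausalModel U V RU RV) (X : V) (x x' : RV X) (Y : V) (y y' : RV Y)
    (ctx : ∀ u, RU u) (z : ∀ v, RV v) : Prop :=
  M.F Y ctx (Function.update z X x) = y ∧ M.F Y ctx (Function.update z X x') = y'

/-- `x` rather than `x'` is a potential parent of `y` rather than `y'`
(single endogenous variables). -/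
def PotParentEE (M : CausalModel U V RU RV) (X : V) (x x' : RV X) (Y : V) (y y' : RV Y) :
    Prop :=
  X ≠ Y ∧ x ≠ x' ∧ y ≠ y' ∧ ∃ ctx z, M.LeadsToWith X x x' Y y y' ctx z

/-- `x` rather than `x'` (values of an exogenous variable `X`) is a potential
parent of `y` rather than `y'`. -/
def PotParentXE (M : CausalModel U V RU RV) (X : U) (x x' : RU X) (Y : V) (y y' : RV Y) :
    Prop :=
  x ≠ x' ∧ y ≠ y' ∧ ∃ (ctx : ∀ u, RU u) (z : ∀ v, RV v),
    M.F Y (Function.update ctx X x) z = y ∧ M.F Y (Function.update ctx X x') z = y'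

/-- `(x,x') ⤳_p (y,y')` for some directed path `p` starting at the exogenous
variable `X`: a chain of single-variable potential-parenthood steps. -/
inductive PotAncX (M : CausalModel U V RU RV) (X : U) (x x' : RU X) :
    ∀ Y : V, RV Y → RV Y → Prop
  | base {Y : V} {y y' : RV Y} : M.PotParentXE X x x' Y y y' → PotAncX M X x x' Y y y'
  | step {Z : V} {z z' : RV Z} {Y : V} {y y' : RV Y} :
      PotAncX M X x x' Z z z' → M.PotParentEE Z z z' Y y y' → PotAncX M X x x' Y y y'

/-- `(x,x') ⤳_p (y,y')` for some directed path `p` between endogenous variables. -/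
inductive PotAncE (M : CausalModel U V RU RV) (X : V) (x x' : RV X) :
    ∀ Y : V, RV Y → RV Y → Prop
  | base {Y : V} {y y' : RV Y} : M.PotParentEE X x x' Y y y' → PotAncE M X x x' Y y y'
  | step {Z : V} {z z' : RV Z} {Y : V} {y y' : RV Y} :
      PotAncE M X x x' Z z z' → M.PotParentEE Z z z' Y y y' → PotAncE M X x x' Y y y'

/-- Direct sufficiency, Def. 3 (with possibly mixed exogenous/endogenous source
`(Se,xe) ∪ (Sv,xv)` and target `(Te,ye) ∪ (Tv,yv)`; in the basic case
`Se = Te = ∅`).  For every context agreeing with the exogenous part of the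
source and every setting `z` of the endogenous variables outside the source and
the target, the target values are guaranteed. -/
def DirectlySufficient (M : CausalModel U V RU RV)
    (Se : Set U) (xe : ∀ u, RU u) (Sv : Set V) (xv : ∀ v, RV v)
    (Te : Set U) (ye : ∀ u, RU u) (Tv : Set V) (yv : ∀ v, RV v) : Prop :=
  ∀ ctx : ∀ u, RU u, (∀ u ∈ Se, ctx u = xe u) →
    (∀ u ∈ Te, ctx u = ye u) ∧
    ∀ z : ∀ v, RV v,
      (M.intervene (Sv ∪ (Sv ∪ Tv)ᶜ) (Sv.piecewise xv z)).Sat ctx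
        fun a => ∀ v ∈ Tv, a v = yv v

/-- `(xv on Sv)` is weakly sufficient for `(yv on Tv)` w.r.t. `(M, ctx)`:
`(M,ctx) ⊨ [Sv ← xv] Tv = yv`. -/
def WeaklySufficient (M : CausalModel U V RU RV) (ctx : ∀ u, RU u)
    (Sv : Set V) (xv : ∀ v, RV v) (Tv : Set V) (yv : ∀ v, RV v) : Prop :=
  (M.intervene Sv xv).Sat ctx fun a => ∀ v ∈ Tv, a v = yv v

/-- Sufficiency, Def. 8: the chaining (transitive closure) of direct sufficiency,
starting from a source that may contain exogenous values `(Se,xe)`. -/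
inductive Sufficient (M : CausalModel U V RU RV)
    (Se : Set U) (xe : ∀ u, RU u) (Sv : Set V) (xv : ∀ v, RV v) :
    Set V → (∀ v, RV v) → Prop
  | base (Tv : Set V) (yv : ∀ v, RV v) :
      M.DirectlySufficient Se xe Sv xv ∅ xe Tv yv → Sufficient M Se xe Sv xv Tv yv
  | step (Tv : Set V) (yv : ∀ v, RV v) (Tv' : Set V) (yv' : ∀ v, RV v) :
      Sufficient M Se xe Sv xv Tv yv →
      M.DirectlySufficient ∅ xe Tv yv ∅ xe Tv' yv' →
      Sufficient M Se xe Sv xv Tv' yv'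

/-- `(x⃗,x⃗') ⤳ (y⃗,y⃗')` via the explicit witness `(Ze,ze) ∪ (Zv,zv)`:
the source and target are distinct sets of variables, the contrast values
differ on the respective domains, `(z⃗,x⃗)` is directly sufficient for `y⃗`,
`(z⃗,x⃗')` is directly sufficient for `y⃗'`, and the source is minimal. -/
def JointParentVia (M : CausalModel U V RU RV)
    (Se : Set U) (xe xe' : ∀ u, RU u) (Sv : Set V) (xv xv' : ∀ v, RV v)
    (Te : Set U) (ye ye' : ∀ u, RU u) (Tv : Set V) (yv yv' : ∀ v, RV v)
    (Ze : Set U) (ze : ∀ u, RU u) (Zv : Set V) (zv : ∀ v, RV v) : Prop :=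
  (¬(Se = Te ∧ Sv = Tv)) ∧
  (∀ u ∈ Se, xe u ≠ xe' u) ∧ (∀ v ∈ Sv, xv v ≠ xv' v) ∧
  (∀ u ∈ Te, ye u ≠ ye' u) ∧ (∀ v ∈ Tv, yv v ≠ yv' v) ∧
  Disjoint Ze Se ∧ Disjoint Zv Sv ∧
  M.DirectlySufficient (Ze ∪ Se) (Se.piecewise xe ze) (Zv ∪ Sv) (Sv.piecewise xv zv)
    Te ye Tv yv ∧
  M.DirectlySufficient (Ze ∪ Se) (Se.piecewise xe' ze) (Zv ∪ Sv) (Sv.piecewise xv' zv)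
    Te ye' Tv yv' ∧
  ∀ (Se' : Set U) (Sv' : Set V), Se' ⊆ Se → Sv' ⊆ Sv → ¬(Se' = Se ∧ Sv' = Sv) →
    ¬(M.DirectlySufficient (Ze ∪ Se') (Se'.piecewise xe ze) (Zv ∪ Sv')
        (Sv'.piecewise xv zv) Te ye Tv yv ∧
      M.DirectlySufficient (Ze ∪ Se') (Se'.piecewise xe' ze) (Zv ∪ Sv')
        (Sv'.piecewise xv' zv) Te ye' Tv yv')

/-- Potential joint parenthood, Def. 4: `(x⃗,x⃗') ⤳ (y⃗,y⃗')` for some witness. -/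
def PotJointParent (M : CausalModel U V RU RV)
    (Se : Set U) (xe xe' : ∀ u, RU u) (Sv : Set V) (xv xv' : ∀ v, RV v)
    (Te : Set U) (ye ye' : ∀ u, RU u) (Tv : Set V) (yv yv' : ∀ v, RV v) : Prop :=
  ∃ (Ze : Set U) (ze : ∀ u, RU u) (Zv : Set V) (zv : ∀ v, RV v),
    M.JointParentVia Se xe xe' Sv xv xv' Te ye ye' Tv yv yv' Ze ze Zv zv

/-- Actual joint parenthood w.r.t. `(M,u)`: potential joint parenthood by a
witness whose exogenous part is contained in `u` and whose endogenous part
(as well as the source) takes its actual value in `(M,u)`. -/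
def ActJointParent (M : CausalModel U V RU RV) (u : ∀ u, RU u)
    (Se : Set U) (xe xe' : ∀ u, RU u) (Sv : Set V) (xv xv' : ∀ v, RV v)
    (Te : Set U) (ye ye' : ∀ u, RU u) (Tv : Set V) (yv yv' : ∀ v, RV v) : Prop :=
  ∃ (Ze : Set U) (ze : ∀ u, RU u) (Zv : Set V) (zv : ∀ v, RV v),
    M.JointParentVia Se xe xe' Sv xv xv' Te ye ye' Tv yv yv' Ze ze Zv zv ∧
    (∀ w ∈ Ze, ze w = u w) ∧ (∀ w ∈ Se, xe w = u w) ∧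
    M.Sat u fun a => (∀ v ∈ Zv, a v = zv v) ∧ (∀ v ∈ Sv, a v = xv v)

/-- Potential joint ancestry, Def. 5: `(x⃗,x⃗') ⤳_n (y⃗,y⃗')` for some network `n`,
i.e. the transitive closure of potential joint parenthood. -/
inductive PotJointAnc (M : CausalModel U V RU RV)
    (Se : Set U) (xe xe' : ∀ u, RU u) (Sv : Set V) (xv xv' : ∀ v, RV v) :
    ∀ (Te : Set U) (ye ye' : ∀ u, RU u) (Tv : Set V) (yv yv' : ∀ v, RV v), Prop
  | base {Te : Set U} {ye ye' : ∀ u, RU u} {Tv : Set V} {yv yv' : ∀ v, RV v} :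
      M.PotJointParent Se xe xe' Sv xv xv' Te ye ye' Tv yv yv' →
      PotJointAnc M Se xe xe' Sv xv xv' Te ye ye' Tv yv yv'
  | step {Te : Set U} {ye ye' : ∀ u, RU u} {Tv : Set V} {yv yv' : ∀ v, RV v}
      {Te' : Set U} {ye2 ye2' : ∀ u, RU u} {Tv' : Set V} {yv2 yv2' : ∀ v, RV v} :
      PotJointAnc M Se xe xe' Sv xv xv' Te ye ye' Tv yv yv' →
      M.PotJointParent Te ye ye' Tv yv yv' Te' ye2 ye2' Tv' yv2 yv2' →
      PotJointAnc M Se xe xe' Sv xv xv' Te' ye2 ye2' Tv' yv2 yv2'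

/-- Actual joint ancestry w.r.t. `(M,u)`, Def. 7. -/
inductive ActJointAnc (M : CausalModel U V RU RV) (u : ∀ u, RU u)
    (Se : Set U) (xe xe' : ∀ u, RU u) (Sv : Set V) (xv xv' : ∀ v, RV v) :
    ∀ (Te : Set U) (ye ye' : ∀ u, RU u) (Tv : Set V) (yv yv' : ∀ v, RV v), Prop
  | base {Te : Set U} {ye ye' : ∀ u, RU u} {Tv : Set V} {yv yv' : ∀ v, RV v} :
      M.ActJointParent u Se xe xe' Sv xv xv' Te ye ye' Tv yv yv' →
      ActJointAnc M u Se xe xe' Sv xv xv' Te ye ye' Tv yv yv'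
  | step {Te : Set U} {ye ye' : ∀ u, RU u} {Tv : Set V} {yv yv' : ∀ v, RV v}
      {Te' : Set U} {ye2 ye2' : ∀ u, RU u} {Tv' : Set V} {yv2 yv2' : ∀ v, RV v} :
      ActJointAnc M u Se xe xe' Sv xv xv' Te ye ye' Tv yv yv' →
      M.ActJointParent u Te ye ye' Tv yv yv' Te' ye2 ye2' Tv' yv2 yv2' →
      ActJointAnc M u Se xe xe' Sv xv xv' Te' ye2 ye2' Tv' yv2 yv2'

/-- Combine a family of values on `A` with a family of values on `B` into a
family of values on `A ⊕ B`. -/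
def extFn {A B : Type} {RA : A → Type} {RB : B → Type}
    (f : ∀ a, RA a) (g : ∀ b, RB b) : ∀ x : A ⊕ B, Sum.elim RA RB x
  | Sum.inl a => f a
  | Sum.inr b => g b

end CausalModel

namespace CausalModel

variable {U V : Type} {RU : U → Type} {RV : V → Type}

/-- Intervening on every variable other than `Y` leaves a model whose solution is the imposed
setting, with `Y` determined by its structural equation. -/
theorem solves_intervene_of_notMem_iff (M : CausalModel U V RU RV) {S : Set V} {Y : V}
    (hS : ∀ v, v ∈ S ↔ v ≠ Y) (ctx : ∀ u, RU u) (a b : ∀ v, RV v) :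
    (M.intervene S b).Solves ctx a ↔ a = Function.update b Y (M.F Y ctx b) := by
  constructor
  · intro h
    have hne : ∀ v, v ≠ Y → a v = b v := fun v hv => by
      simpa [intervene, (hS v).2 hv] using h v
    funext v
    by_cases hv : v = Y
    · subst hv
      have h' : a v = M.F v ctx a := by simpa [intervene, hS] using h v
      rw [h', Function.update_self]
      exact M.selfIndep v ctx a b hne
    · rw [Function.update_of_ne hv, hne v hv]
  · rintro rfl v
    by_cases hv : v = Y
    · subst hv
      simpa [intervene, hS] using M.selfIndep v ctx b _
        fun w hw => (Function.update_of_ne hw _ _).symm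
    · simp [intervene, hS, hv]

/-- Direct sufficiency for a single variable outside the source is a condition on its structural
equation. -/
theorem directlySufficient_singleton_iff (M : CausalModel U V RU RV) (Se : Set U)
    (xe ye : ∀ u, RU u) {Sv : Set V} (xv yv : ∀ v, RV v) {Y : V} (hY : Y ∉ Sv) :
    M.DirectlySufficient Se xe Sv xv ∅ ye {Y} yv ↔
      ∀ ctx : ∀ u, RU u, (∀ u ∈ Se, ctx u = xe u) →
        ∀ z : ∀ v, RV v, M.F Y ctx (Sv.piecewise xv z) = yv Y := by
  have hS : ∀ v, v ∈ Sv ∪ (Sv ∪ {Y})ᶜ ↔ v ≠ Y := by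
    intro v
    by_cases hv : v = Y
    · subst hv; simp [hY]
    · by_cases hvS : v ∈ Sv <;> simp [hv, hvS]
  simp only [DirectlySufficient, Sat, solves_intervene_of_notMem_iff M hS]
  simp

/-- If the source contains `Y`, it can only be directly sufficient for its own value of `Y`. -/
theorem DirectlySufficient.eq_of_mem {M : CausalModel U V RU RV} {Se : Set U}
    {xe ye : ∀ u, RU u} {Sv : Set V} {xv yv : ∀ v, RV v} {Y : V} (hY : Y ∈ Sv)
    (h : M.DirectlySufficient Se xe Sv xv ∅ ye {Y} yv) : xv Y = yv Y := by
  have hsub : Sv ∪ {Y} = Sv := Set.union_eq_left.2 (Set.singleton_subset_iff.2 hY)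
  have hsol : (M.intervene (Sv ∪ (Sv ∪ {Y})ᶜ) (Sv.piecewise xv xv)).Solves xe xv := by
    intro v
    rw [hsub, Set.union_compl_self]
    simp [intervene]
  exact (h xe fun _ _ => rfl).2 xv xv hsol Y rfl

end CausalModel

/-- When restricted to singletons, potential joint parenthood
(Def. 4) coincides with potential parenthood (Def. 1): `x` rather than `x'` is
a potential joint parent of `y` rather than `y'` (i.e. there is a witness set
of variable values such that together with `X = x` it is directly sufficient
for `Y = y`, together with `X = x'` it is directly sufficient for `Y = y'`,
and `{X}` is minimal) iff there are a context `u` and a setting `z` of the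
endogenous variables other than `X` and `Y` with `F_Y(x,z,u) = y` and
`F_Y(x',z,u) = y'`. -/
theorem jointParent_singleton_iff {U V : Type} [Finite U] [Finite V]
    {RU : U → Type} {RV : V → Type}
    (hRU : ∀ u, Nonempty (RU u)) (hRV : ∀ v, Nonempty (RV v))
    (M : CausalModel U V RU RV) (hM : M.StronglyRecursive)
    (X Y : V) (hXY : X ≠ Y)
    (x x' : RV X) (hx : x ≠ x') (y y' : RV Y) (hy : y ≠ y') :
    (∃ (xe : ∀ u, RU u) (xv xv' yv yv' : ∀ v, RV v),
        xv X = x ∧ xv' X = x' ∧ yv Y = y ∧ yv' Y = y' ∧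
        M.PotJointParent ∅ xe xe {X} xv xv' ∅ xe xe {Y} yv yv')
    ↔
    (∃ (u : ∀ u, RU u) (z : ∀ v, RV v),
        M.F Y u (Function.update z X x) = y ∧ M.F Y u (Function.update z X x') = y') := by
  constructor
  · rintro ⟨xe, xv, xv', yv, yv', rfl, rfl, rfl, rfl, Ze, ze, Zv, zv, -, -, -, -, -, -, -, h, h', -⟩
    have hpw : ∀ (w : ∀ v, RV v) [∀ v, Decidable (v ∈ Zv ∪ {X})]
        [∀ v, Decidable (v ∈ ({X} : Set V))], (Zv ∪ {X}).piecewise (Set.piecewise {X} w zv) zv =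
        Function.update zv X (w X) := by
      intro w _ _
      funext v
      by_cases hv : v = X
      · subst hv; simp
      · by_cases hvZ : v ∈ Zv <;> simp [Set.piecewise, hv, hvZ]
    by_cases hYZ : Y ∈ Zv
    · have e := h.eq_of_mem (Set.mem_union_left _ hYZ)
      have e' := h'.eq_of_mem (Set.mem_union_left _ hYZ)
      simp only [Set.piecewise, Set.mem_singleton_iff, hXY.symm, if_false] at e e'
      exact absurd (e.symm.trans e') hy
    · have hYS : Y ∉ Zv ∪ {X} := by simp [hYZ, hXY.symm]
      rw [CausalModel.directlySufficient_singleton_iff M _ _ _ _ _ hYS] at h h'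
      refine ⟨ze, zv, ?_, ?_⟩
      · simpa only [hpw] using h ze (by simp) zv
      · simpa only [hpw] using h' ze (by simp) zv
  · rintro ⟨u, z, h, h'⟩
    have hYS : Y ∉ ({X, Y}ᶜ ∪ {X} : Set V) := by simp [hXY.symm]
    have hYZ : Y ∉ ({X, Y}ᶜ ∪ ∅ : Set V) := by simp
    have hpw : ∀ (t : RV X) (w : ∀ v, RV v)
        [∀ v, Decidable (v ∈ ({X, Y}ᶜ ∪ {X} : Set V))]
        [∀ v, Decidable (v ∈ ({X} : Set V))],
        M.F Y u (({X, Y}ᶜ ∪ {X} : Set V).piecewise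
          (Set.piecewise {X} (Function.update z X t) z) w) =
        M.F Y u (Function.update z X t) := by
      intro t w _ _
      refine M.selfIndep Y u _ _ fun v hv => ?_
      by_cases hvX : v = X
      · subst hvX; simp
      · simp [Set.piecewise, hvX, hv]
    refine ⟨u, Function.update z X x, Function.update z X x', Function.update z Y y,
      Function.update z Y y', by simp, by simp, by simp, by simp,
      Set.univ, u, {X, Y}ᶜ, z, by simpa using hXY, by simp, by simpa using hx, by simp,
      by simpa using hy, by simp, by simp, ?_, ?_, ?_⟩
    · rw [CausalModel.directlySufficient_singleton_iff M _ _ _ _ _ hYS]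
      intro ctx hc w
      obtain rfl : ctx = u := funext fun i => by simpa using hc i (Or.inl trivial)
      rw [hpw, h, Function.update_self]
    · rw [CausalModel.directlySufficient_singleton_iff M _ _ _ _ _ hYS]
      intro ctx hc w
      obtain rfl : ctx = u := funext fun i => by simpa using hc i (Or.inl trivial)
      rw [hpw, h', Function.update_self]
    · rintro Se' Sv' hSe hSv hne ⟨hs, hs'⟩
      obtain rfl := Set.subset_empty_iff.1 hSe
      obtain rfl | rfl := Set.subset_singleton_iff_eq.1 hSv
      · rw [CausalModel.directlySufficient_singleton_iff M _ _ _ _ _ hYZ] at hs hs'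
        have e := hs u (by simp) z
        have e' := hs' u (by simp) z
        simp only [Set.piecewise_empty, Function.update_self] at e e'
        exact hy (e.symm.trans e')
      · exact hne ⟨rfl, rfl⟩
end

section
/- If x⃗ is directly sufficient for y⃗ in a strongly recursive causal model M, then for every context u⃗, x⃗ is weakly sufficient for y⃗ with respect to (M,u⃗), i.e., (M,u⃗) ⊨ [X⃗←x⃗] Y⃗ = y⃗. -/
set_option linter.unusedVariables false

attribute [local instance] Classical.propDecidable

namespace CausalModel

variable {U V : Type} {RU : U → Type} {RV : V → Type}

/-- A solution of an intervened model remains a solution when further variables are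
set to the values they already take in it. -/
theorem Solves.intervene_union {M : CausalModel U V RU RV} {ctx : ∀ u, RU u}
    {S : Set V} {b a : ∀ v, RV v} (ha : (M.intervene S b).Solves ctx a) (T : Set V) :
    (M.intervene (S ∪ T) (S.piecewise b a)).Solves ctx a := by
  intro X
  have hX := ha X
  by_cases hS : X ∈ S <;> by_cases hT : X ∈ T <;> simp_all [intervene]

end CausalModel

/-- If `x⃗` is directly sufficient for `y⃗` in a strongly recursive
causal model `M`, then for every context `u`, `x⃗` is weakly sufficient for `y⃗`
with respect to `(M,u)`, i.e. `(M,u) ⊨ [X⃗ ← x⃗] Y⃗ = y⃗`. -/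
theorem directlySufficient_weaklySufficient {U V : Type} [Finite U] [Finite V]
    {RU : U → Type} {RV : V → Type}
    (hRU : ∀ u, Nonempty (RU u)) (hRV : ∀ v, Nonempty (RV v))
    (M : CausalModel U V RU RV) (hM : M.StronglyRecursive)
    (xe : ∀ u, RU u) (Sv : Set V) (xv : ∀ v, RV v) (Tv : Set V) (yv : ∀ v, RV v)
    (h : M.DirectlySufficient ∅ xe Sv xv ∅ xe Tv yv) :
    ∀ u : ∀ u, RU u, M.WeaklySufficient u Sv xv Tv yv := by
  intro u a ha
  exact (h u (by simp)).2 a a (ha.intervene_union _)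
end

section
/- Theorem 1: Let M = ((U,V,R),F) and M' = ((U',V',R'),F') be strongly recursive causal models with U ⊆ U', V ⊆ V', and W⃗ = U' − U, and let w⃗ ∈ R(W⃗). If M and M' are functionally equivalent with witness w⃗, then M and M' are conservatively equivalent with witness w⃗. -/
set_option linter.unusedVariables false

attribute [local instance] Classical.propDecidable

namespace CausalModel

section

variable {U V : Type} {RU : U → Type} {RV : V → Type}

/-- The equation of `Y` only reads the variables that `Y` depends on. -/
theorem F_congr_of_dependsOnE [Finite V] (M : CausalModel U V RU RV) (Y : V)
    (ctx : ∀ u, RU u) {a b : ∀ v, RV v} (h : ∀ X, M.DependsOnE Y X → a X = b X) :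
    M.F Y ctx a = M.F Y ctx b := by
  have : Fintype V := Fintype.ofFinite V
  have key : ∀ s : Finset V, M.F Y ctx (s.piecewise b a) = M.F Y ctx a := by
    intro s
    induction s using Finset.induction_on with
    | empty => simp
    | insert w s hw ih =>
      rw [Finset.piecewise_insert, ← ih]
      by_cases hwY : w = Y
      · subst hwY
        exact M.selfIndep _ _ _ _ fun Z hZ => Function.update_of_ne hZ _ _
      · by_contra hne
        have hdep : M.DependsOnE Y w := by
          refine ⟨hwY, ctx, s.piecewise b a, b w, s.piecewise b a w, ?_⟩
          rwa [Function.update_eq_self]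
        apply hne
        congr 1
        rw [← h w hdep, Function.update_eq_iff]
        simp [hw]
  have := key Finset.univ
  rw [Finset.piecewise_univ] at this
  exact this.symm

theorem dependsOnE_of_intervene {M : CausalModel U V RU RV} {S : Set V} {b : ∀ v, RV v}
    {Y X : V} (h : (M.intervene S b).DependsOnE Y X) : M.DependsOnE Y X := by
  obtain ⟨hXY, ctx, a, x, x', hne⟩ := h
  refine ⟨hXY, ctx, a, x, x', fun heq => hne ?_⟩
  simp only [intervene, heq]

theorem StronglyRecursive.intervene {M : CausalModel U V RU RV} (hM : M.StronglyRecursive)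
    (S : Set V) (b : ∀ v, RV v) : (M.intervene S b).StronglyRecursive := by
  obtain ⟨lt, hlt, h⟩ := hM
  exact ⟨lt, hlt, fun Y X hYX => h Y X (dependsOnE_of_intervene hYX)⟩

theorem StronglyRecursive.exists_wellFounded [Finite V] {M : CausalModel U V RU RV}
    (hM : M.StronglyRecursive) :
    ∃ lt : V → V → Prop, WellFounded lt ∧ ∀ Y X : V, M.DependsOnE Y X → lt X Y := by
  obtain ⟨lt, hlt, h⟩ := hM
  exact ⟨lt, Finite.wellFounded_of_trans_of_irrefl lt, h⟩

theorem StronglyRecursive.exists_solves [Finite V] {M : CausalModel U V RU RV}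
    (hRV : ∀ v, Nonempty (RV v)) (hM : M.StronglyRecursive) (ctx : ∀ u, RU u) :
    ∃ a, M.Solves ctx a := by
  obtain ⟨lt, hwf, h⟩ := hM.exists_wellFounded
  let step : ∀ v, (∀ w, lt w v → RV w) → RV v := fun v r =>
    M.F v ctx fun w => if hw : lt w v then r w hw else (hRV w).some
  refine ⟨hwf.fix step, fun v => ?_⟩
  rw [hwf.fix_eq]
  refine M.F_congr_of_dependsOnE v ctx fun w hw => ?_
  simp [h v w hw]

theorem StronglyRecursive.solves_unique [Finite V] {M : CausalModel U V RU RV}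
    (hM : M.StronglyRecursive) {ctx : ∀ u, RU u} {a b : ∀ v, RV v}
    (ha : M.Solves ctx a) (hb : M.Solves ctx b) : a = b := by
  obtain ⟨lt, hwf, h⟩ := hM.exists_wellFounded
  funext v
  induction v using hwf.induction with
  | _ v ih =>
    rw [ha v, hb v]
    exact M.F_congr_of_dependsOnE v ctx fun w hw => ih w (h v w hw)

/-- The solution of `M_{S ← x}` is sufficient from the full context together with `x`. -/
theorem sufficient_univ_of_solves_intervene [Finite V] {M : CausalModel U V RU RV}
    (hM : M.StronglyRecursive) {ctx : ∀ u, RU u} {S : Set V} {x s : ∀ v, RV v}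
    (hs : (M.intervene S x).Solves ctx s) :
    M.Sufficient Set.univ ctx S x Set.univ s := by
  refine .base _ _ fun ctx' hctx => ⟨by simp, fun z a ha v _ => ?_⟩
  obtain rfl : ctx' = ctx := funext fun u => hctx u (Set.mem_univ u)
  refine congrFun ((hM.intervene S x).solves_unique (fun w => ?_) hs) v
  rw [ha w]
  by_cases hw : w ∈ S <;> simp [CausalModel.intervene, hw]

/-- A target value of a directly sufficient set is either a source value, or is computed by
its equation from any assignment that agrees with source and target on the dependencies. -/
theorem DirectlySufficient.eq_of_agree [Finite V] {M : CausalModel U V RU RV}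
    (hRV : ∀ v, Nonempty (RV v)) (hM : M.StronglyRecursive)
    {ctx : ∀ u, RU u} {Se : Set U} {xe : ∀ u, RU u} (hctx : ∀ u ∈ Se, ctx u = xe u)
    {Te : Set U} {ye : ∀ u, RU u}
    {S T : Set V} {x y : ∀ v, RV v} (h : M.DirectlySufficient Se xe S x Te ye T y)
    (a : ∀ v, RV v) {v : V} (hv : v ∈ T)
    (hS : ∀ w, M.DependsOnE v w → w ∈ S → x w = a w)
    (hT : ∀ w, M.DependsOnE v w → w ∈ T → y w = a w) :
    (v ∈ S → y v = x v) ∧ (v ∉ S → y v = M.F v ctx a) := by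
  obtain ⟨b, hb⟩ := (hM.intervene (S ∪ (S ∪ T)ᶜ) (S.piecewise x a)).exists_solves hRV ctx
  have hbT : ∀ w ∈ T, b w = y w := (h ctx hctx).2 a b hb
  have hbS : ∀ w ∈ S, b w = x w := fun w hw => by
    rw [hb w]; simp [CausalModel.intervene, hw]
  refine ⟨fun hvS => by rw [← hbT v hv, hbS v hvS], fun hvS => ?_⟩
  rw [← hbT v hv, hb v]
  simp only [CausalModel.intervene, Set.mem_union, Set.mem_compl_iff, hvS, hv, or_true,
    not_true_eq_false, or_self, if_false]
  refine M.F_congr_of_dependsOnE v ctx fun w hw => ?_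
  by_cases hwS : w ∈ S
  · rw [hbS w hwS, hS w hw hwS]
  · by_cases hwT : w ∈ T
    · rw [hbT w hwT, hT w hw hwT]
    · rw [hb w]
      simp [CausalModel.intervene, hwS, hwT]

/-- Sufficiency unfolded into a finite sequence of directly sufficient steps. -/
theorem Sufficient.exists_chain {M : CausalModel U V RU RV} {ctx : ∀ u, RU u}
    {Se : Set U} {xe : ∀ u, RU u} (hctx : ∀ u ∈ Se, ctx u = xe u)
    {S T : Set V} {x y : ∀ v, RV v} (h : M.Sufficient Se xe S x T y) :
    ∃ (n : ℕ) (D : ℕ → Set V) (d : ℕ → ∀ v, RV v),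
      D 0 = S ∧ d 0 = x ∧ D n = T ∧ d n = y ∧
      ∀ i < n, ∃ Se' : Set U, (∀ u ∈ Se', ctx u = xe u) ∧
        M.DirectlySufficient Se' xe (D i) (d i) ∅ xe (D (i + 1)) (d (i + 1)) := by
  induction h with
  | base T y h =>
    refine ⟨1, fun i => if i = 0 then S else T, fun i => if i = 0 then x else y,
      by simp, by simp, by simp, by simp, fun i hi => ⟨Se, hctx, ?_⟩⟩
    obtain rfl : i = 0 := by omega
    simpa using h
  | step T y T' y' _ h ih =>
    obtain ⟨n, D, d, hD, hd, hDn, hdn, hstep⟩ := ih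
    refine ⟨n + 1, fun i => if i ≤ n then D i else T', fun i => if i ≤ n then d i else y',
      by simpa, by simpa, by simp, by simp, fun i hi => ?_⟩
    rcases Nat.lt_succ_iff_lt_or_eq.1 hi with hi | rfl
    · obtain ⟨Se', h₁, h₂⟩ := hstep i hi
      refine ⟨Se', h₁, ?_⟩
      simpa [hi.le, Nat.succ_le_of_lt hi] using h₂
    · exact ⟨∅, by simp, by simpa [hDn, hdn] using h⟩

/-- Sufficiency implies weak sufficiency as soon as the target retains the source values. -/
theorem Sufficient.weaklySufficient [Finite V] {M : CausalModel U V RU RV}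
    (hRV : ∀ v, Nonempty (RV v)) (hM : M.StronglyRecursive)
    {ctx : ∀ u, RU u} {Se : Set U} {xe : ∀ u, RU u} (hctx : ∀ u ∈ Se, ctx u = xe u)
    {S T : Set V} {x y : ∀ v, RV v} (h : M.Sufficient Se xe S x T y)
    (hST : S ⊆ T) (hxy : ∀ v ∈ S, y v = x v) : M.WeaklySufficient ctx S x T y := by
  intro a ha
  obtain ⟨n, D, d, rfl, rfl, rfl, rfl, hstep⟩ := h.exists_chain hctx
  obtain ⟨lt, hwf, hlt⟩ := hM.exists_wellFounded
  suffices H : ∀ v, ∀ i ≤ n, v ∈ D i → d i v = a v from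
    fun v hv => (H v n le_rfl hv).symm
  intro v
  induction v using hwf.induction with
  | _ v ih =>
    have next : ∀ i < n, v ∈ D (i + 1) →
        (v ∈ D i → d (i + 1) v = d i v) ∧ (v ∉ D i → d (i + 1) v = M.F v ctx a) := by
      intro i hi hv
      obtain ⟨Se', hctx', hds⟩ := hstep i hi
      exact hds.eq_of_agree hRV hM hctx' a hv
        (fun w hw => ih w (hlt v w hw) i hi.le) (fun w hw => ih w (hlt v w hw) (i + 1) hi)
    have hav : v ∈ D 0 → a v = d 0 v := fun hv => by
      rw [ha v]; simp [CausalModel.intervene, hv]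
    by_cases hk : a v = M.F v ctx a
    · intro i
      induction i with
      | zero => exact fun _ hv => (hav hv).symm
      | succ i ihi =>
        intro hi hv
        by_cases hvi : v ∈ D i
        · rw [(next i hi hv).1 hvi, ihi (by omega) hvi]
        · rw [(next i hi hv).2 hvi, ← hk]
    · have hv0 : v ∈ D 0 := by
        by_contra hv
        apply hk
        have := ha v
        simpa [CausalModel.intervene, hv] using this
      suffices H : ∀ i ≤ n, v ∈ D i ∧ d i v = a v from fun i hi _ => (H i hi).2
      intro i hi
      induction hi using Nat.decreasingInduction with
      | self => exact ⟨hST hv0, by rw [hxy v hv0, hav hv0]⟩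
      | of_succ i hi ihi =>
        obtain ⟨hv, hd⟩ := ihi
        by_cases hvi : v ∈ D i
        · exact ⟨hvi, by rw [← (next i hi hv).1 hvi, hd]⟩
        · exact absurd (hd.symm.trans ((next i hi hv).2 hvi)) hk

end

end CausalModel

open CausalModel in
/-- Theorem 1: Let `M = ((U,V,R),F)` and
`M' = ((U ⊕ W, V ⊕ V₂, R'), F')` be strongly recursive causal models (so the
exogenous resp. endogenous variables of `M` are contained in those of `M'`,
with `W = U' − U` the marginalized exogenous variables), and let `wv` be a
setting of the variables in `W`.  If `M` and `M'` are functionally equivalent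
with witness `wv` — i.e. for all `X⃗ ⊆ V ∪ U`, `Y⃗ ⊆ V` and values `x⃗`, `y⃗`:
`x⃗` is sufficient for `y⃗` in `M` iff `(wv,x⃗)` is sufficient for `y⃗` in `M'` —
then `M` and `M'` are conservatively equivalent with witness `wv`: for all
`X⃗ ⊆ V`, `Y⃗ ⊆ V`, values `x⃗`, `y⃗` and contexts `u`, `(u,x⃗)` is weakly
sufficient for `y⃗` in `M` iff `(wv,u,x⃗)` is weakly sufficient for `y⃗` in `M'`. -/
theorem functionallyEquivalent_implies_conservativelyEquivalent
    {U W V V₂ : Type} [Finite U] [Finite W] [Finite V] [Finite V₂]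
    {RU : U → Type} {RW : W → Type} {RV : V → Type} {RV₂ : V₂ → Type}
    (hRU : ∀ u, Nonempty (RU u)) (hRW : ∀ w, Nonempty (RW w))
    (hRV : ∀ v, Nonempty (RV v)) (hRV₂ : ∀ v, Nonempty (RV₂ v))
    (M : CausalModel U V RU RV)
    (M' : CausalModel (U ⊕ W) (V ⊕ V₂) (Sum.elim RU RW) (Sum.elim RV RV₂))
    (hM : M.StronglyRecursive) (hM' : M'.StronglyRecursive)
    (wv : ∀ w, RW w) (d₂ : ∀ v, RV₂ v)
    (hfun : ∀ (Se : Set U) (xe : ∀ u, RU u) (Sv : Set V) (xv : ∀ v, RV v)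
        (Tv : Set V) (yv : ∀ v, RV v),
        M.Sufficient Se xe Sv xv Tv yv ↔
        M'.Sufficient (Sum.inl '' Se ∪ Sum.inr '' (Set.univ : Set W)) (extFn xe wv)
          (Sum.inl '' Sv) (extFn xv d₂) (Sum.inl '' Tv) (extFn yv d₂)) :
    ∀ (Sv : Set V) (xv : ∀ v, RV v) (Tv : Set V) (yv : ∀ v, RV v) (u : ∀ u, RU u),
      M.WeaklySufficient u Sv xv Tv yv ↔
      M'.WeaklySufficient (extFn u wv) (Sum.inl '' Sv) (extFn xv d₂)
        (Sum.inl '' Tv) (extFn yv d₂) := by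
  intro Sv xv Tv yv u
  have hRV' : ∀ v : V ⊕ V₂, Nonempty (Sum.elim RV RV₂ v) := by
    rintro (v | v)
    exacts [hRV v, hRV₂ v]
  have agree : ∀ s, (M.intervene Sv xv).Solves u s → ∀ a,
      (M'.intervene (Sum.inl '' Sv) (extFn xv d₂)).Solves (extFn u wv) a →
      ∀ v : V, a (Sum.inl v) = s v := by
    intro s hs a ha v
    have hsuff := (hfun _ _ _ _ _ _).1 (sufficient_univ_of_solves_intervene hM hs)
    refine hsuff.weaklySufficient hRV' hM' (ctx := extFn u wv) (fun _ _ => rfl)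
      (Set.image_mono (Set.subset_univ _)) ?_ a ha (Sum.inl v) ⟨v, Set.mem_univ v, rfl⟩
    rintro _ ⟨w, hw, rfl⟩
    change s w = xv w
    rw [hs w]
    simp [CausalModel.intervene, hw]
  obtain ⟨s, hs⟩ := (hM.intervene Sv xv).exists_solves hRV u
  obtain ⟨a, ha⟩ := (hM'.intervene (Sum.inl '' Sv) (extFn xv d₂)).exists_solves hRV' (extFn u wv)
  constructor
  · rintro h b hb _ ⟨v, hv, rfl⟩
    exact (agree s hs b hb v).trans (h s hs v hv)
  · intro h t ht v hv
    exact (agree t ht a ha v).symm.trans (h a ha (Sum.inl v) ⟨v, hv, rfl⟩)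
end
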